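/- arXiv:1610.06901 — 6 statements merged into one kernel-verified Lean document; each statement's English description precedes it below -/
import Mathlib

section
/- Let u : ℝ × ℝ^N → ℂ be smooth, with u(t, ·) a Schwartz function for each t (with all seminorm bounds locally uniform in t), satisfying i∂_t u + Δu + |x|^{−b}|u|^{2σ}u = 0 for all t and all x ≠ 0. Then for every t, (d/dt) ∫_{ℝ^N} |x|² |u(x,t)|² dx = 4 Im ∫_{ℝ^N} \bar{u}(x,t) (x · ∇u(x,t)) dx. -/
open MeasureTheory ENNReal NNReal

noncomputable section

/-- The Laplacian of a function on `ℝ^N`, as the sum of second partial derivatives. -/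
def laplacian {N : ℕ} {F : Type*} [NormedAddCommGroup F] [NormedSpace ℝ F]
    (f : EuclideanSpace ℝ (Fin N) → F) (x : EuclideanSpace ℝ (Fin N)) : F :=
  ∑ i : Fin N,
    fderiv ℝ (fun y => fderiv ℝ f y (EuclideanSpace.single i 1)) x (EuclideanSpace.single i 1)

/-- The `L²` norm `‖u‖_{L²} = (∫ |u|²)^{1/2}`. -/
def l2Norm {N : ℕ} {F : Type*} [NormedAddCommGroup F]
    (u : EuclideanSpace ℝ (Fin N) → F) : ℝ :=
  Real.sqrt (∫ x, ‖u x‖ ^ 2)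

/-- The `L²` norm of the gradient, `‖∇u‖_{L²} = (∫ |∇u|²)^{1/2}`. -/
def gradL2Norm {N : ℕ} {F : Type*} [NormedAddCommGroup F] [NormedSpace ℝ F]
    (u : EuclideanSpace ℝ (Fin N) → F) : ℝ :=
  Real.sqrt (∫ x, ‖fderiv ℝ u x‖ ^ 2)

/-- `x · ∇u = Σ_j x_j ∂u/∂x_j`. -/
def xdotGrad {N : ℕ} (u : EuclideanSpace ℝ (Fin N) → ℂ) (x : EuclideanSpace ℝ (Fin N)) : ℂ :=
  ∑ i : Fin N, (x i : ℂ) * fderiv ℝ u x (EuclideanSpace.single i 1)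

open scoped SchwartzMap

theorem exists_schwartz_dir {N : ℕ} (f : 𝓢(EuclideanSpace ℝ (Fin N), ℂ))
    (v : EuclideanSpace ℝ (Fin N)) :
    ∃ g : 𝓢(EuclideanSpace ℝ (Fin N), ℂ), ∀ x, g x = fderiv ℝ f x v :=
  ⟨LineDeriv.lineDerivOp v f, fun x => by
    rw [SchwartzMap.lineDerivOp_apply_eq_fderiv]⟩

theorem integrable_weight {N : ℕ} (g h : 𝓢(EuclideanSpace ℝ (Fin N), ℂ))
    (φ : EuclideanSpace ℝ (Fin N) → ℝ) (hφ : Continuous φ) (C : ℝ) (k : ℕ)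
    (hb : ∀ x, |φ x| ≤ C * ‖x‖ ^ k) :
    Integrable (fun x => (φ x : ℂ) * ((starRingEnd ℂ) (g x) * h x)) := by
  obtain ⟨B, hB⟩ : ∃ B, ∀ x, ‖h x‖ ≤ B := ⟨_, h.norm_le_seminorm ℝ⟩
  refine (((g.integrable_pow_mul volume k).const_mul C).mul_const B).mono' ?_ ?_
  · have h1 := g.continuous
    have h2 := h.continuous
    exact (by fun_prop : Continuous (fun x => (φ x : ℂ) * ((starRingEnd ℂ) (g x) * h x))).aestronglyMeasurable
  · filter_upwards with x
    rw [norm_mul, norm_mul, RCLike.norm_conj, Complex.norm_real, Real.norm_eq_abs]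
    have h1 := mul_le_mul (hb x) (mul_le_mul_of_nonneg_left (hB x) (norm_nonneg (g x)))
      (by positivity) ((abs_nonneg _).trans (hb x))
    linarith

theorem integrable_weight_im {N : ℕ} (g h : 𝓢(EuclideanSpace ℝ (Fin N), ℂ))
    (φ : EuclideanSpace ℝ (Fin N) → ℝ) (hφ : Continuous φ) (C : ℝ) (k : ℕ)
    (hb : ∀ x, |φ x| ≤ C * ‖x‖ ^ k) :
    Integrable (fun x => φ x * ((starRingEnd ℂ) (g x) * h x).im) := by
  have := (integrable_weight g h φ hφ C k hb).im
  refine this.congr ?_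
  filter_upwards with x
  exact Complex.im_ofReal_mul _ _

theorem fderiv_im_conj {N : ℕ} (g h : 𝓢(EuclideanSpace ℝ (Fin N), ℂ))
    (x v : EuclideanSpace ℝ (Fin N)) :
    DifferentiableAt ℝ (fun x => ((starRingEnd ℂ) (g x) * h x).im) x ∧
    fderiv ℝ (fun x => ((starRingEnd ℂ) (g x) * h x).im) x v
      = ((starRingEnd ℂ) (fderiv ℝ g x v) * h x + (starRingEnd ℂ) (g x) * fderiv ℝ h x v).im := by
  have hg : HasFDerivAt (fun x => (starRingEnd ℂ) (g x)) _ x :=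
    (Complex.conjCLE : ℂ →L[ℝ] ℂ).hasFDerivAt.comp x (g.differentiableAt (x := x)).hasFDerivAt
  have hh := (h.differentiableAt (x := x)).hasFDerivAt
  have := Complex.imCLM.hasFDerivAt.comp x (hg.mul hh)
  have h2 : HasFDerivAt (fun x => ((starRingEnd ℂ) (g x) * h x).im) _ x := this
  refine ⟨h2.differentiableAt, ?_⟩
  rw [h2.fderiv]
  simp
  ring

theorem fderiv_norm_sq_single {N : ℕ} (x : EuclideanSpace ℝ (Fin N)) (i : Fin N) :
    fderiv ℝ (fun x : EuclideanSpace ℝ (Fin N) => ‖x‖ ^ 2) x (EuclideanSpace.single i 1)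
      = 2 * x i := by
  rw [fderiv_norm_sq_apply]
  simp [EuclideanSpace.inner_single_right]

theorem ibp_single {N : ℕ} (f : 𝓢(EuclideanSpace ℝ (Fin N), ℂ)) (i : Fin N) :
    Integrable (fun x => ‖x‖ ^ 2 * ((starRingEnd ℂ) (f x) *
      fderiv ℝ (fun y => fderiv ℝ f y (EuclideanSpace.single i 1)) x
        (EuclideanSpace.single i 1)).im) ∧
    Integrable (fun x => (x i : ℂ) * ((starRingEnd ℂ) (f x) *
      fderiv ℝ f x (EuclideanSpace.single i 1))) ∧
    ∫ x, ‖x‖ ^ 2 * ((starRingEnd ℂ) (f x) *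
      fderiv ℝ (fun y => fderiv ℝ f y (EuclideanSpace.single i 1)) x
        (EuclideanSpace.single i 1)).im
      = - (2 * (∫ x, (x i : ℂ) * ((starRingEnd ℂ) (f x) *
      fderiv ℝ f x (EuclideanSpace.single i 1))).im) := by
  obtain ⟨g, hg⟩ := exists_schwartz_dir f (EuclideanSpace.single i 1)
  obtain ⟨h, hh⟩ := exists_schwartz_dir g (EuclideanSpace.single i 1)
  have hg' : (fun y => fderiv ℝ f y (EuclideanSpace.single i 1)) = g := by
    ext y; exact (hg y).symm
  rw [hg']
  simp only [← hg, ← hh]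
  have c2 : Continuous (fun x : EuclideanSpace ℝ (Fin N) => ‖x‖ ^ 2) := by fun_prop
  have c1 : Continuous (fun x : EuclideanSpace ℝ (Fin N) => x i) := by fun_prop
  have b2 : ∀ x : EuclideanSpace ℝ (Fin N), |‖x‖ ^ 2| ≤ 1 * ‖x‖ ^ 2 := fun x => by
    rw [abs_of_nonneg (by positivity), one_mul]
  have b1 : ∀ x : EuclideanSpace ℝ (Fin N), |x i| ≤ 1 * ‖x‖ ^ 1 := fun x => by
    have := PiLp.norm_apply_le x i
    simpa using this
  have I1 := integrable_weight_im f h _ c2 1 2 b2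
  have I2 := integrable_weight f g _ c1 1 1 b1
  have I2' := integrable_weight_im f g _ c1 1 1 b1
  have I3 := integrable_weight_im f g _ c2 1 2 b2
  refine ⟨I1, I2, ?_⟩
  have e : ∀ x, fderiv ℝ (fun x => ((starRingEnd ℂ) (f x) * g x).im) x (EuclideanSpace.single i 1)
      = ((starRingEnd ℂ) (f x) * h x).im := fun x => by
    rw [(fderiv_im_conj f g x _).2, ← hg, ← hh, Complex.add_im]
    have : ((starRingEnd ℂ) (g x) * g x).im = 0 := by
      rw [mul_comm, Complex.mul_conj]; exact Complex.ofReal_im _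
    rw [this, zero_add]
  have key := integral_mul_fderiv_eq_neg_fderiv_mul_of_integrable (𝕜 := ℝ)
    (μ := (volume : Measure (EuclideanSpace ℝ (Fin N))))
    (f := fun x => ‖x‖ ^ 2) (g := fun x => ((starRingEnd ℂ) (f x) * g x).im)
    (v := EuclideanSpace.single i 1) ?_ ?_ I3 ?_ ?_
  · simp only [e, fderiv_norm_sq_single] at key
    rw [key]
    congr 1
    have : (∫ x, (x i : ℂ) * ((starRingEnd ℂ) (f x) * g x)).im
        = ∫ x : EuclideanSpace ℝ (Fin N), x i * ((starRingEnd ℂ) (f x) * g x).im := by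
      rw [← Complex.imCLM_apply, ← Complex.imCLM.integral_comp_comm I2]
      refine integral_congr_ae (Filter.Eventually.of_forall fun x => ?_)
      exact Complex.im_ofReal_mul _ _
    rw [this, ← integral_const_mul]
    simp only [mul_assoc]
  · simp only [fderiv_norm_sq_single, mul_assoc]
    exact I2'.const_mul 2
  · simpa only [e] using I1
  · intro x _; exact (contDiff_norm_sq ℝ (n := 1)).differentiable (by simp) x
  · intro x _; exact (fderiv_im_conj f g x 0).1

theorem fixed_time {N : ℕ} (f : 𝓢(EuclideanSpace ℝ (Fin N), ℂ)) :
    ∫ x, -2 * (‖x‖ ^ 2 * ((starRingEnd ℂ) (f x) * laplacian f x).im)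
      = 4 * (∫ x, (starRingEnd ℂ) (f x) * xdotGrad f x).im := by
  rw [integral_const_mul]
  simp only [laplacian, xdotGrad, Finset.mul_sum, Complex.im_sum]
  rw [integral_finsetSum _ fun i _ => (ibp_single f i).1]
  simp only [mul_left_comm ((starRingEnd ℂ) _) (Complex.ofReal _)]
  rw [integral_finsetSum _ fun i _ => (ibp_single f i).2.1]
  simp only [fun i => (ibp_single f i).2.2, Complex.im_sum]
  rw [Finset.sum_neg_distrib, ← Finset.mul_sum]
  ring

theorem norm_laplacian_le {N : ℕ} (f : EuclideanSpace ℝ (Fin N) → ℂ) (hf : ContDiff ℝ (⊤ : ℕ∞) f)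
    (x : EuclideanSpace ℝ (Fin N)) : ‖laplacian f x‖ ≤ N * ‖iteratedFDeriv ℝ 2 f x‖ := by
  have : ∀ i ∈ Finset.univ, ‖fderiv ℝ (fun y => fderiv ℝ f y (EuclideanSpace.single i 1)) x
      (EuclideanSpace.single i (1 : ℝ))‖ ≤ ‖iteratedFDeriv ℝ 2 f x‖ := fun i _ => by
    have hd : DifferentiableAt ℝ (fderiv ℝ f) x :=
      (hf.fderiv_right (m := 1) (by exact WithTop.coe_le_coe.2 le_top)).differentiable (by simp) x
    have e : fderiv ℝ (fun y => fderiv ℝ f y (EuclideanSpace.single i 1)) x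
      (EuclideanSpace.single i (1 : ℝ)) = iteratedFDeriv ℝ 2 f x (fun _ => EuclideanSpace.single i 1) := by
      rw [iteratedFDeriv_two_apply, fderiv_clm_apply hd (by fun_prop)]
      simp
    rw [e]
    refine (ContinuousMultilinearMap.le_opNorm _ _).trans ?_
    simp
  refine (norm_sum_le_of_le _ this).trans ?_
  simp

/-- **First Virial identity** (Proposition 4.1, identity (4.22)): for a smooth solution of
`i∂_t u + Δu + |x|^{−b}|u|^{2σ}u = 0` which is Schwartz in `x` locally uniformly in `t`,
`(d/dt) ∫ |x|² |u(x,t)|² dx = 4 Im ∫ ū(x,t) (x · ∇u(x,t)) dx`. -/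
theorem virial_first_identity
    (N : ℕ) (hN : 1 ≤ N) (b σ : ℝ)
    (hb0 : 0 < b) (hb2 : b < 2) (hbN : b < N)
    (hσ1 : (2 - b) / N < σ) (hσ2 : 3 ≤ N → σ < (2 - b) / ((N : ℝ) - 2))
    (u : ℝ → EuclideanSpace ℝ (Fin N) → ℂ)
    (hsmooth : ContDiff ℝ (⊤ : ℕ∞) (Function.uncurry u))
    (hSchwartz : ∀ (k n : ℕ) (R : ℝ), ∃ C : ℝ,
        ∀ (t : ℝ) (x : EuclideanSpace ℝ (Fin N)), |t| ≤ R →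
          ‖x‖ ^ k * ‖iteratedFDeriv ℝ n (u t) x‖ ≤ C)
    (heq : ∀ (t : ℝ) (x : EuclideanSpace ℝ (Fin N)), x ≠ 0 →
        Complex.I * deriv (fun s => u s x) t + laplacian (u t) x
          + ((‖x‖ ^ (-b) : ℝ) : ℂ) * ((‖u t x‖ ^ (2 * σ) : ℝ) : ℂ) * u t x = 0) :
    ∀ t : ℝ, HasDerivAt (fun s : ℝ => ∫ x, ‖x‖ ^ 2 * ‖u s x‖ ^ 2)
        (4 * (∫ x, (starRingEnd ℂ) (u t x) * xdotGrad (u t) x).im) t := by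
  intro t
  have hsm : ∀ s, ContDiff ℝ (⊤ : ℕ∞) (u s) := fun s =>
    hsmooth.comp (contDiff_const.prodMk contDiff_id)
  have hSch : ∀ s, ∃ f : 𝓢(EuclideanSpace ℝ (Fin N), ℂ), ⇑f = u s := fun s =>
    ⟨⟨u s, hsm s, fun k n => by
      obtain ⟨C, hC⟩ := hSchwartz k n |s|
      exact ⟨C, fun x => hC s x le_rfl⟩⟩, rfl⟩
  obtain ⟨f, hf⟩ := hSch t
  rw [← hf, ← fixed_time f, hf]
  have : Nonempty (Fin N) := ⟨⟨0, hN⟩⟩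
  have hne : ∀ᵐ x : EuclideanSpace ℝ (Fin N), x ≠ 0 := by simp [ae_iff]
  set p := (volume : Measure (EuclideanSpace ℝ (Fin N))).integrablePower with hp
  obtain ⟨C₁, hC₁⟩ := hSchwartz 0 0 (|t| + 1)
  obtain ⟨C₂, hC₂⟩ := hSchwartz (2 + p) 0 (|t| + 1)
  obtain ⟨C₃, hC₃⟩ := hSchwartz 0 2 (|t| + 1)
  simp only [norm_iteratedFDeriv_zero, pow_zero, one_mul] at hC₁ hC₂ hC₃
  have hball : ∀ s ∈ Metric.ball t 1, |s| ≤ |t| + 1 := fun s hs => by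
    rw [Metric.mem_ball, Real.dist_eq] at hs
    have := abs_sub_abs_le_abs_sub s t
    linarith
  have hC₃0 : 0 ≤ C₃ := (norm_nonneg _).trans (hC₃ t 0 (by linarith))
  have cont : ∀ s, Continuous (u s) := fun s => (hsm s).continuous
  refine (hasDerivAt_integral_of_dominated_loc_of_deriv_le
    (F := fun s x => ‖x‖ ^ 2 * ‖u s x‖ ^ 2)
    (F' := fun s x => -2 * (‖x‖ ^ 2 * ((starRingEnd ℂ) (u s x) * laplacian (u s) x).im))
    (bound := fun x => 2 * (2 ^ p * (C₁ + C₂) * (1 + ‖x‖) ^ (-(p : ℝ)) * (N * C₃)))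
    (Metric.ball_mem_nhds t one_pos) ?_ ?_ ?_ ?_ ?_ ?_).2
  · refine Filter.Eventually.of_forall fun s => ?_
    have := cont s
    exact (by fun_prop : Continuous fun x => ‖x‖ ^ 2 * ‖u s x‖ ^ 2).aestronglyMeasurable
  · have := (integrable_weight f f (fun x => ‖x‖ ^ 2) (by fun_prop) 1 2
      (fun x => by rw [abs_of_nonneg (by positivity), one_mul])).re
    refine this.congr (Filter.Eventually.of_forall fun x => ?_)
    rw [← hf]
    change Complex.re _ = _
    rw [Complex.re_ofReal_mul, mul_comm ((starRingEnd ℂ) _), Complex.mul_conj, Complex.ofReal_re,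
      Complex.normSq_eq_norm_sq]
  · have hl : Continuous (laplacian (u t)) := by
      unfold laplacian
      refine continuous_finsetSum _ fun i _ => ?_
      obtain ⟨g, hg⟩ := exists_schwartz_dir f (EuclideanSpace.single i 1)
      obtain ⟨h, hh⟩ := exists_schwartz_dir g (EuclideanSpace.single i 1)
      rw [← hf]
      have hg' : (fun y => fderiv ℝ f y (EuclideanSpace.single i 1)) = g := by
        ext y; exact (hg y).symm
      rw [hg']
      simp only [← hh]
      exact h.continuous
    have := cont t
    refine Continuous.aestronglyMeasurable ?_
    fun_prop
  · refine Filter.Eventually.of_forall fun x s hs => ?_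
    have hs' := hball s hs
    have h1 := pow_mul_le_of_le_of_pow_mul_le (norm_nonneg x) (norm_nonneg (u s x))
      (hC₁ s x hs') (hC₂ s x hs')
    have h2 := (norm_laplacian_le (u s) (hsm s) x).trans
      (mul_le_mul_of_nonneg_left (hC₃ s x hs') (Nat.cast_nonneg N))
    have h3 : |((starRingEnd ℂ) (u s x) * laplacian (u s) x).im| ≤ ‖u s x‖ * ‖laplacian (u s) x‖ := by
      refine (Complex.abs_im_le_norm _).trans ?_
      rw [norm_mul, RCLike.norm_conj]
    rw [norm_mul, norm_mul, norm_neg, Real.norm_two, norm_pow, norm_norm, Real.norm_eq_abs]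
    have h4 := mul_le_mul h1 h2 (norm_nonneg _) (le_trans (by positivity) h1)
    have h5 := mul_le_mul_of_nonneg_left h3 (by positivity : 0 ≤ ‖x‖ ^ 2)
    linarith
  · exact (((Measure.integrable_pow_neg_integrablePower volume).const_mul _).mul_const _).const_mul _
  · filter_upwards [hne] with x hx s _
    have hd : DifferentiableAt ℝ (fun s => u s x) s :=
      ((hsmooth.comp (contDiff_id.prodMk contDiff_const) :
        ContDiff ℝ (⊤ : ℕ∞) (fun s => u s x)).differentiable (by simp)) s
    have h1 := (hd.hasDerivAt.norm_sq).const_mul (‖x‖ ^ 2)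
    refine h1.congr_deriv ?_
    have h2 := heq s x hx
    generalize deriv (fun s => u s x) s = d at h2 ⊢
    generalize laplacian (u s) x = l at h2 ⊢
    generalize u s x = w at h2 ⊢
    rw [mul_comm (Complex.ofReal _) (Complex.ofReal _), ← Complex.ofReal_mul] at h2
    generalize ‖w‖ ^ (2 * σ) * ‖x‖ ^ (-b) = r at h2
    have hre := congrArg Complex.re h2
    have him := congrArg Complex.im h2
    simp at hre him
    rw [Complex.inner]
    simp
    linear_combination (2 * ‖x‖ ^ 2) * (w.re * him - w.im * hre)
end
end

section
/- Let 0 < b < min{2, N} and σ > 0. For every Schwartz function u : ℝ^N → ℂ, Re ∫_{ℝ^N} |x|^{−b} |u(x)|^{2σ} u(x) (x · ∇\bar{u}(x)) dx = −((N−b)/(2(σ+1))) ∫_{ℝ^N} |x|^{−b} |u(x)|^{2σ+2} dx. -/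
open MeasureTheory ENNReal NNReal

noncomputable section

theorem aux_weight_integrable (N : ℕ) (hN : 1 ≤ N) (b : ℝ) (hb0 : 0 < b) (hbN : b < N) :
    Integrable (fun x : EuclideanSpace ℝ (Fin N) => ‖x‖ ^ (-b) * ((1 + ‖x‖) ^ N)⁻¹) := by
  have : Nonempty (Fin N) := ⟨⟨0, hN⟩⟩
  refine (integrable_fun_norm_addHaar (volume : Measure (EuclideanSpace ℝ (Fin N)))
    (f := fun r : ℝ => r ^ (-b) * ((1 + r) ^ N)⁻¹)).2 ?_
  rw [finrank_euclideanSpace_fin]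
  have hm : Measurable (fun y : ℝ => y ^ (N - 1) • (y ^ (-b) * ((1 + y) ^ N)⁻¹)) := by
    fun_prop
  have hpow : ∀ y : ℝ, 0 < y → y ^ (N - 1) = y ^ ((N : ℝ) - 1) := by
    intro y hy
    rw [← Real.rpow_natCast]
    congr 1
    push_cast [Nat.cast_sub hN]
    ring
  rw [← Set.Ioo_union_Ici_eq_Ioi (zero_lt_one' ℝ), integrableOn_union,
    integrableOn_Ici_iff_integrableOn_Ioi]
  constructor
  · have h1 : IntegrableOn (fun y : ℝ => y ^ ((N : ℝ) - 1 - b)) (Set.Ioo 0 1) :=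
      (intervalIntegral.integrableOn_Ioo_rpow_iff zero_lt_one).2 (by linarith)
    refine Integrable.mono' h1 hm.aestronglyMeasurable ?_
    refine (ae_restrict_iff' measurableSet_Ioo).2 (Filter.Eventually.of_forall fun y hy => ?_)
    have hy0 : 0 < y := hy.1
    rw [Real.norm_of_nonneg (by positivity), smul_eq_mul, hpow y hy0, ← mul_assoc,
      ← Real.rpow_add hy0, ← sub_eq_add_neg]
    refine mul_le_of_le_one_right (by positivity) (inv_le_one_of_one_le₀ ?_)
    exact one_le_pow₀ (by linarith)
  · have h1 : IntegrableOn (fun y : ℝ => y ^ (-1 - b)) (Set.Ioi 1) :=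
      integrableOn_Ioi_rpow_of_lt (by linarith) zero_lt_one
    refine Integrable.mono' h1 hm.aestronglyMeasurable ?_
    refine (ae_restrict_iff' measurableSet_Ioi).2 (Filter.Eventually.of_forall fun y hy => ?_)
    have hy0 : 0 < y := lt_trans zero_lt_one hy
    rw [Real.norm_of_nonneg (by positivity), smul_eq_mul, hpow y hy0, ← mul_assoc,
      ← Real.rpow_add hy0]
    have h2 : ((1 + y) ^ N)⁻¹ ≤ y ^ (-(N : ℝ)) := by
      rw [Real.rpow_neg hy0.le, Real.rpow_natCast]
      gcongr
      linarith
    calc y ^ ((N : ℝ) - 1 + -b) * ((1 + y) ^ N)⁻¹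
        ≤ y ^ ((N : ℝ) - 1 + -b) * y ^ (-(N : ℝ)) := by gcongr
      _ = y ^ (-1 - b) := by
        rw [← Real.rpow_add hy0]
        congr 1
        ring

theorem aux_xdotGrad {N : ℕ} (u : EuclideanSpace ℝ (Fin N) → ℂ) (x : EuclideanSpace ℝ (Fin N)) :
    xdotGrad u x = fderiv ℝ u x x := by
  have hx : x = ∑ i : Fin N, x i • EuclideanSpace.single i (1 : ℝ) := by
    ext j
    simp [Finset.sum_apply, Pi.single_apply]
  conv_rhs => rw [hx]
  rw [map_sum]
  unfold xdotGrad
  refine Finset.sum_congr rfl fun i _ => ?_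
  rw [map_smul, ← hx, Complex.real_smul]

theorem aux_decay {N : ℕ} (u : SchwartzMap (EuclideanSpace ℝ (Fin N)) ℂ) :
    ∃ C : ℝ, 0 < C ∧ (∀ x, ‖u x‖ ≤ C) ∧ (∀ x, ‖u x‖ ≤ C * ((1 + ‖x‖) ^ N)⁻¹) ∧
      ∀ (x : EuclideanSpace ℝ (Fin N)) (t : ℝ), 1 / 2 ≤ t →
        ‖fderiv ℝ u (t • x) x‖ ≤ C * ((1 + ‖x‖) ^ N)⁻¹ := by
  set A : ℝ := 2 ^ (N + 1) *
    ((Finset.Iic (N + 1, 1)).sup fun m => SchwartzMap.seminorm ℝ m.1 m.2) u with hA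
  have h0 : ∀ x, (1 + ‖x‖) ^ N * ‖u x‖ ≤ A := fun x => by
    have := SchwartzMap.one_add_le_sup_seminorm_apply (𝕜 := ℝ) (m := (N + 1, 1)) (k := N) (n := 0)
      (by simp) (by simp) u x
    rwa [norm_iteratedFDeriv_zero] at this
  have h1 : ∀ x, (1 + ‖x‖) ^ (N + 1) * ‖fderiv ℝ u x‖ ≤ A := fun x => by
    have := SchwartzMap.one_add_le_sup_seminorm_apply (𝕜 := ℝ) (m := (N + 1, 1)) (k := N + 1)
      (n := 1) (by simp) (by simp) u x
    rwa [norm_iteratedFDeriv_one] at this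
  have hA0 : 0 ≤ A := le_trans (by positivity) (h0 0)
  have hAC : A ≤ 2 ^ (N + 1) * A + 1 := by
    have : (1 : ℝ) ≤ 2 ^ (N + 1) := one_le_pow₀ (by norm_num)
    nlinarith
  refine ⟨2 ^ (N + 1) * A + 1, by positivity, fun x => ?_, fun x => ?_, fun x t ht => ?_⟩
  · refine le_trans ?_ ((h0 x).trans hAC)
    exact le_mul_of_one_le_left (norm_nonneg _) (one_le_pow₀ (by linarith [norm_nonneg x]))
  · rw [← div_eq_mul_inv, le_div_iff₀ (by positivity), mul_comm]
    exact (h0 x).trans hAC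
  · rw [← div_eq_mul_inv, le_div_iff₀ (by positivity)]
    have hn : ‖t • x‖ = t * ‖x‖ := by
      rw [norm_smul, Real.norm_of_nonneg (by linarith)]
    have hx2 : ‖x‖ ≤ 2 * (1 + ‖t • x‖) := by
      rw [hn]; nlinarith [norm_nonneg x]
    have hx3 : 1 + ‖x‖ ≤ 2 * (1 + ‖t • x‖) := by
      rw [hn]; nlinarith [norm_nonneg x]
    calc ‖fderiv ℝ u (t • x) x‖ * (1 + ‖x‖) ^ N
        ≤ (‖fderiv ℝ u (t • x)‖ * ‖x‖) * (1 + ‖x‖) ^ N := by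
          gcongr; exact ContinuousLinearMap.le_opNorm _ _
      _ ≤ (‖fderiv ℝ u (t • x)‖ * (2 * (1 + ‖t • x‖))) * (2 * (1 + ‖t • x‖)) ^ N := by
          gcongr
      _ = 2 ^ (N + 1) * ((1 + ‖t • x‖) ^ (N + 1) * ‖fderiv ℝ u (t • x)‖) := by
          rw [mul_pow]; ring
      _ ≤ 2 ^ (N + 1) * A := by gcongr; exact h1 _
      _ ≤ _ := by linarith

/-- Identity (4.29): for `0 < b < min{2, N}`, `σ > 0` and every Schwartz `u : ℝ^N → ℂ`,
`Re ∫ |x|^{−b} |u|^{2σ} u (x · ∇ū) dx = −((N−b)/(2(σ+1))) ∫ |x|^{−b} |u|^{2σ+2} dx`. -/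
theorem nonlinearity_xdotgrad_identity
    (N : ℕ) (hN : 1 ≤ N) (b σ : ℝ)
    (hb0 : 0 < b) (hb2 : b < 2) (hbN : b < N) (hσ : 0 < σ)
    (u : SchwartzMap (EuclideanSpace ℝ (Fin N)) ℂ) :
    (∫ x, ((‖x‖ ^ (-b) : ℝ) : ℂ) * ((‖u x‖ ^ (2 * σ) : ℝ) : ℂ) * u x
        * (starRingEnd ℂ) (xdotGrad (⇑u) x)).re
      = -((((N : ℝ) - b) / (2 * (σ + 1))) * ∫ x, ‖x‖ ^ (-b) * ‖u x‖ ^ (2 * σ + 2)) := by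
  
  obtain ⟨C, hC, hu0, hu1, hdu⟩ := aux_decay u
  have hK := aux_weight_integrable N hN b hb0 hbN
  have hwm : Measurable (fun x : EuclideanSpace ℝ (Fin N) => ‖x‖ ^ (-b)) := by fun_prop
  have huc : Continuous (fun x => u x) := u.continuous
  have hdc : Continuous (fun x => fderiv ℝ u x) :=
    (u.smooth 1).continuous_fderiv (by norm_num)
  have hdxc : Continuous (fun x => fderiv ℝ u x x) := hdc.clm_apply continuous_id
  have hsq : ∀ y, (‖u y‖ ^ 2) ^ (σ + 1) = ‖u y‖ ^ (2 * σ + 2) := fun y => by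
    rw [← Real.rpow_natCast, ← Real.rpow_mul (norm_nonneg _)]
    congr 1
    push_cast
    ring
  have hsq' : ∀ y, (‖u y‖ ^ 2) ^ (σ + 1 - 1) = ‖u y‖ ^ (2 * σ) := fun y => by
    rw [← Real.rpow_natCast, ← Real.rpow_mul (norm_nonneg _)]
    congr 1
    push_cast
    ring
  have hub : ∀ y, ‖u y‖ ^ (2 * σ) ≤ C ^ (2 * σ) := fun y =>
    Real.rpow_le_rpow (norm_nonneg _) (hu0 y) (by linarith)
  -- the family
  set F : ℝ → EuclideanSpace ℝ (Fin N) → ℝ :=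
    fun t x => ‖x‖ ^ (-b) * (‖u (t • x)‖ ^ 2) ^ (σ + 1) with hF
  set F' : ℝ → EuclideanSpace ℝ (Fin N) → ℝ :=
    fun t x => ‖x‖ ^ (-b) * (2 * inner ℝ (u (t • x)) (fderiv ℝ u (t • x) x) * (σ + 1)
      * (‖u (t • x)‖ ^ 2) ^ (σ + 1 - 1)) with hF'
  have hFm : ∀ t, AEStronglyMeasurable (F t) volume := fun t => by
    refine hwm.aestronglyMeasurable.mul (Continuous.aestronglyMeasurable ?_)
    refine Continuous.rpow_const (by fun_prop) fun _ => Or.inr (by linarith)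
  have hFi : Integrable (F 1) := by
    refine Integrable.mono' (hK.const_mul (C ^ (2 * σ) * C * C)) (hFm 1)
      (Filter.Eventually.of_forall fun x => ?_)
    simp only [hF, one_smul]
    rw [Real.norm_of_nonneg (by positivity), hsq, Real.rpow_add_of_nonneg (norm_nonneg _)
      (by linarith) (by norm_num), Real.rpow_two]
    calc ‖x‖ ^ (-b) * (‖u x‖ ^ (2 * σ) * ‖u x‖ ^ 2)
        = ‖x‖ ^ (-b) * (‖u x‖ ^ (2 * σ) * ‖u x‖ * ‖u x‖) := by ring
      _ ≤ ‖x‖ ^ (-b) * (C ^ (2 * σ) * C * (C * ((1 + ‖x‖) ^ N)⁻¹)) := by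
          gcongr
          · exact hu0 x
          · exact hu0 x
          · exact hu1 x
      _ = _ := by ring
  have hF'm : AEStronglyMeasurable (F' 1) volume := by
    refine hwm.aestronglyMeasurable.mul (Continuous.aestronglyMeasurable ?_)
    simp only [one_smul]
    refine Continuous.mul ?_ (Continuous.rpow_const (by fun_prop) fun _ => Or.inr (by linarith))
    exact (continuous_const.mul (huc.inner hdxc)).mul continuous_const
  have hder := hasDerivAt_integral_of_dominated_loc_of_deriv_le (μ := volume) (F := F) (F' := F')
    (x₀ := (1 : ℝ)) (s := Set.Ioi (1 / 2 : ℝ))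
    (bound := fun x => (2 * (C * C) * (σ + 1) * C ^ (2 * σ)) *
      (‖x‖ ^ (-b) * ((1 + ‖x‖) ^ N)⁻¹))
    (Ioi_mem_nhds (by norm_num)) (Filter.Eventually.of_forall hFm) hFi hF'm
    (Filter.Eventually.of_forall fun x t ht => by
      have ht' : 1 / 2 ≤ t := le_of_lt ht
      simp only [hF']
      rw [hsq', norm_mul, norm_mul, norm_mul, norm_mul, Real.norm_of_nonneg (r := ‖x‖ ^ (-b))
        (by positivity), Real.norm_of_nonneg (r := 2) (by norm_num),
        Real.norm_of_nonneg (r := σ + 1) (by linarith),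
        Real.norm_of_nonneg (r := ‖u (t • x)‖ ^ (2 * σ)) (by positivity)]
      calc ‖x‖ ^ (-b) * (2 * ‖(inner ℝ (u (t • x)) (fderiv ℝ u (t • x) x) : ℝ)‖ * (σ + 1)
            * ‖u (t • x)‖ ^ (2 * σ))
          ≤ ‖x‖ ^ (-b) * (2 * (C * (C * ((1 + ‖x‖) ^ N)⁻¹)) * (σ + 1) * C ^ (2 * σ)) := by
            gcongr
            · refine (norm_inner_le_norm _ _).trans ?_
              gcongr
              · exact hu0 _
              · exact hdu x t ht'
            · exact hu0 _
        _ = _ := by ring)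
    (hK.const_mul _)
    (Filter.Eventually.of_forall fun x t ht => by
      have h1 : HasDerivAt (fun s : ℝ => s • x) x t := by
        simpa using (hasDerivAt_id t).smul_const x
      have h2 : HasDerivAt (fun s : ℝ => u (s • x)) (fderiv ℝ u (t • x) x) t :=
        (u.differentiable (t • x)).hasFDerivAt.comp_hasDerivAt t h1
      exact ((h2.norm_sq).rpow_const (Or.inr (by linarith))).const_mul _)
  -- scaling
  have hscale : ∀ t : ℝ, 0 < t → ∫ x, F t x = t ^ (b - N) * ∫ x, F 1 x := by
    intro t ht
    have h1 := Measure.integral_comp_smul (volume : Measure (EuclideanSpace ℝ (Fin N))) (F 1) t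
    have h2 : ∀ x, F 1 (t • x) = t ^ (-b) * F t x := fun x => by
      simp only [hF, one_smul]
      rw [norm_smul, Real.norm_of_nonneg ht.le, Real.mul_rpow ht.le (norm_nonneg _)]
      ring
    simp only [h2] at h1
    rw [integral_const_mul, finrank_euclideanSpace_fin, abs_of_pos (by positivity),
      smul_eq_mul] at h1
    have h3 : ∫ x, F t x = t ^ b * (t ^ (-b) * ∫ x, F t x) := by
      rw [← mul_assoc, ← Real.rpow_add ht]
      simp
    rw [h3, h1, ← mul_assoc, Real.rpow_sub ht, Real.rpow_natCast, div_eq_mul_inv]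
  have hder2 : HasDerivAt (fun t => ∫ x, F t x) ((b - N) * ∫ x, F 1 x) 1 := by
    have h1 : HasDerivAt (fun t : ℝ => t ^ (b - N) * ∫ x, F 1 x) ((b - N) * ∫ x, F 1 x) 1 := by
      have := (Real.hasDerivAt_rpow_const (x := 1) (p := b - N) (Or.inl one_ne_zero)).mul_const
        (∫ x, F 1 x)
      simpa using this
    refine h1.congr_of_eventuallyEq ?_
    filter_upwards [Ioi_mem_nhds (zero_lt_one' ℝ)] with t ht using hscale t ht
  have hkey := hder.2.unique hder2
  -- conclusion
  have hci : Integrable (fun x => ((‖x‖ ^ (-b) : ℝ) : ℂ) * ((‖u x‖ ^ (2 * σ) : ℝ) : ℂ) * u x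
        * (starRingEnd ℂ) (xdotGrad (⇑u) x)) := by
    simp only [aux_xdotGrad]
    refine Integrable.mono' (hK.const_mul (C ^ (2 * σ) * C * C)) ?_
      (Filter.Eventually.of_forall fun x => ?_)
    · have hc1 : Continuous (fun x => ((‖u x‖ ^ (2 * σ) : ℝ) : ℂ)) :=
        Complex.continuous_ofReal.comp
          (Continuous.rpow_const (by fun_prop) fun _ => Or.inr (by linarith))
      exact (((Complex.measurable_ofReal.comp hwm).aestronglyMeasurable.mul
        hc1.aestronglyMeasurable).mul huc.aestronglyMeasurable).mul
        (Complex.continuous_conj.comp hdxc).aestronglyMeasurable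
    · have hd := hdu x 1 (by norm_num)
      rw [one_smul] at hd
      rw [norm_mul, norm_mul, norm_mul, RCLike.norm_conj, Complex.norm_real, Complex.norm_real,
        Real.norm_of_nonneg (by positivity), Real.norm_of_nonneg (by positivity)]
      calc ‖x‖ ^ (-b) * ‖u x‖ ^ (2 * σ) * ‖u x‖ * ‖fderiv ℝ u x x‖
          ≤ ‖x‖ ^ (-b) * C ^ (2 * σ) * C * (C * ((1 + ‖x‖) ^ N)⁻¹) := by
            gcongr
            · exact hu0 x
            · exact hu0 x
        _ = _ := by ring
  have hre := integral_re hci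
  simp only [RCLike.re_eq_complex_re] at hre
  rw [← hre]
  have hpt : ∀ x, F' 1 x = (2 * (σ + 1)) * (((‖x‖ ^ (-b) : ℝ) : ℂ) *
      ((‖u x‖ ^ (2 * σ) : ℝ) : ℂ) * u x * (starRingEnd ℂ) (xdotGrad (⇑u) x)).re := fun x => by
    simp only [hF', one_smul]
    rw [hsq', aux_xdotGrad, mul_assoc (((‖x‖ ^ (-b) : ℝ) : ℂ) * _),
      mul_assoc ((‖x‖ ^ (-b) : ℝ) : ℂ), Complex.re_ofReal_mul, Complex.re_ofReal_mul,
      real_inner_comm, Complex.inner]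
    ring
  have hF1 : ∀ x, F 1 x = ‖x‖ ^ (-b) * ‖u x‖ ^ (2 * σ + 2) := fun x => by
    simp only [hF, one_smul, hsq]
  simp only [hpt, hF1] at hkey
  rw [integral_const_mul] at hkey
  have hs : 2 * (σ + 1) ≠ 0 := by positivity
  refine mul_left_cancel₀ hs ?_
  rw [hkey]
  field_simp
  ring
end
end

section
/- Let a > 0 and α > 2, and define f(x) = (1/2)x² − a x^α for x ≥ 0. Then f has a unique positive critical point x_max = (aα)^{−1/(α−2)}, at which it attains a positive local maximum, and a unique positive root x_root = (2a)^{−1/(α−2)}, with x_max < x_root. Let p be the parabola tangent to f at (x_max, f(x_max)) passing through (x_root, 0), i.e. p(x) = f(x_max)(1 − (x − x_max)²/(x_root − x_max)²). Then f(x) ≥ p(x) for all x ∈ [x_max, x_root]. -/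
noncomputable section

/-- **Tangent parabola lemma** (Lemma 5.1): let `f(x) = (1/2)x² − a x^α` with `a > 0`, `α > 2`.
Then `f` has a unique positive critical point `x_max = (aα)^{−1/(α−2)}`, at which it attains a
positive local maximum, a unique positive root `x_root = (2a)^{−1/(α−2)}`, with
`x_max < x_root`; and the parabola `p` tangent to `f` at `(x_max, f(x_max))` passing through
`(x_root, 0)` satisfies `p(x) ≤ f(x)` on `[x_max, x_root]`. -/
theorem tangent_parabola_lemma
    (a α : ℝ) (ha : 0 < a) (hα : 2 < α)
    (f : ℝ → ℝ) (hf : ∀ x : ℝ, f x = (1 / 2) * x ^ 2 - a * x ^ α)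
    (xmax xroot : ℝ)
    (hxmax : xmax = (a * α) ^ (-(1 : ℝ) / (α - 2)))
    (hxroot : xroot = (2 * a) ^ (-(1 : ℝ) / (α - 2)))
    (p : ℝ → ℝ)
    (hp : ∀ x : ℝ, p x = f xmax * (1 - (x - xmax) ^ 2 / (xroot - xmax) ^ 2)) :
    (∀ x : ℝ, 0 < x → (deriv f x = 0 ↔ x = xmax)) ∧
      0 < f xmax ∧ IsLocalMax f xmax ∧
      (∀ x : ℝ, 0 < x → (f x = 0 ↔ x = xroot)) ∧
      xmax < xroot ∧
      (∀ x ∈ Set.Icc xmax xroot, p x ≤ f x) := by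
  have hβ : 0 < α - 2 := by linarith
  have haα : 0 < a * α := by positivity
  have h2a : 0 < 2 * a := by positivity
  have key : ∀ b : ℝ, 0 < b → b * (b ^ (-(1 : ℝ) / (α - 2))) ^ (α - 2) = 1 := by
    intro b hb
    rw [← Real.rpow_mul hb.le, div_mul_cancel₀ _ hβ.ne', Real.rpow_neg_one,
      mul_inv_cancel₀ hb.ne']
  have hm0 : 0 < xmax := by rw [hxmax]; positivity
  have hr0 : 0 < xroot := by rw [hxroot]; positivity
  have hm : a * α * xmax ^ (α - 2) = 1 := by rw [hxmax]; exact key _ haα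
  have hr : 2 * a * xroot ^ (α - 2) = 1 := by rw [hxroot]; exact key _ h2a
  clear hxmax hxroot key
  have e2 : ∀ x : ℝ, 0 < x → x ^ α = x ^ (α - 2) * x ^ 2 := by
    intro x hx
    rw [← Real.rpow_natCast x 2, ← Real.rpow_add hx]; norm_num
  have e1 : ∀ x : ℝ, 0 < x → x ^ (α - 1) = x ^ (α - 2) * x := by
    intro x hx
    nth_rewrite 3 [← Real.rpow_one x]
    rw [← Real.rpow_add hx]; ring_nf
  have hd : ∀ x : ℝ, 0 < x → HasDerivAt f (x - a * (α * x ^ (α - 1))) x := by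
    intro x hx
    have hfe : f = fun x => (1 / 2) * x ^ 2 - a * x ^ α := funext hf
    rw [hfe]
    have h1 := ((hasDerivAt_pow 2 x).const_mul (1 / 2 : ℝ)).sub
      ((Real.hasDerivAt_rpow_const (p := α) (Or.inl hx.ne')).const_mul a)
    refine h1.congr_deriv ?_
    norm_num
    ring
  have hd' : ∀ x : ℝ, 0 < x → deriv f x = x * (1 - a * α * x ^ (α - 2)) := by
    intro x hx
    rw [(hd x hx).deriv, e1 x hx]; ring
  have hfm : 0 < f xmax := by
    rw [hf, e2 _ hm0]
    have h3 : a * xmax ^ (α - 2) < 1 / 2 := by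
      have : 0 < xmax ^ (α - 2) := by positivity
      have : 0 < a * xmax ^ (α - 2) := by positivity
      nlinarith
    have : 0 < xmax ^ 2 := by positivity
    nlinarith
  have hfr : f xroot = 0 := by
    rw [hf, e2 _ hr0]; linear_combination (-xroot ^ 2 / 2) * hr
  have hlt : xmax < xroot := by
    rw [← Real.rpow_lt_rpow_iff hm0.le hr0.le hβ]
    have : 0 < xmax ^ (α - 2) := by positivity
    have h4 : 0 < a * xmax ^ (α - 2) := by positivity
    have : a * xmax ^ (α - 2) < a * xroot ^ (α - 2) := by nlinarith
    exact lt_of_mul_lt_mul_left this ha.le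
  refine ⟨?_, hfm, ?_, ?_, hlt, ?_⟩
  · intro x hx
    rw [hd' x hx]
    constructor
    · intro h
      have h5 : 1 - a * α * x ^ (α - 2) = 0 := (mul_eq_zero.1 h).resolve_left hx.ne'
      rw [← Real.rpow_left_inj hx.le hm0.le hβ.ne']
      apply mul_left_cancel₀ haα.ne'
      linarith
    · rintro rfl
      rw [hm]; ring
  · apply isLocalMax_of_deriv_Ioo (a := 0) (c := xroot) hm0 hlt (hd _ hm0).continuousAt
    · intro x hx
      exact (hd x hx.1).differentiableAt.differentiableWithinAt
    · intro x hx
      exact (hd x (hm0.trans hx.1)).differentiableAt.differentiableWithinAt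
    · intro x hx
      rw [hd' x hx.1]
      have := mul_le_mul_of_nonneg_left (Real.rpow_le_rpow hx.1.le hx.2.le hβ.le) haα.le
      exact mul_nonneg hx.1.le (by linarith)
    · intro x hx
      have hx0 := hm0.trans hx.1
      rw [hd' x hx0]
      have := mul_le_mul_of_nonneg_left (Real.rpow_le_rpow hm0.le hx.1.le hβ.le) haα.le
      exact mul_nonpos_of_nonneg_of_nonpos hx0.le (by linarith)
  · intro x hx
    constructor
    · intro h
      rw [hf, e2 x hx] at h
      have h5 : x ^ 2 * (1 - 2 * a * x ^ (α - 2)) = 0 := by linarith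
      have h6 := (mul_eq_zero.1 h5).resolve_left (by positivity)
      rw [← Real.rpow_left_inj hx.le hr0.le hβ.ne']
      apply mul_left_cancel₀ h2a.ne'
      linarith
    · rintro rfl
      exact hfr
  · intro x hx
    by_contra! hlt'
    have hsq : (xroot - xmax) ^ 2 ≠ 0 := pow_ne_zero _ (by linarith)
    set c := f xmax / (xroot - xmax) ^ 2 with hc
    have hpc : ∀ y, p y = f xmax - c * (y - xmax) ^ 2 := by
      intro y; rw [hp, hc]; ring
    have hpr : p xroot = 0 := by rw [hp, div_self hsq]; ring
    have hpm : p xmax = f xmax := by rw [hpc]; ring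
    have hxm : xmax < x := lt_of_le_of_ne hx.1 (by rintro rfl; linarith)
    have hxr : x < xroot := lt_of_le_of_ne hx.2 (by rintro rfl; linarith)
    let G : ℝ → ℝ := fun y => y - a * (α * y ^ (α - 1)) + c * (2 * (y - xmax))
    have hg : ∀ y : ℝ, 0 < y → HasDerivAt (fun y => f y - p y) (G y) y := by
      intro y hy
      have hpe : p = fun y => f xmax - c * (y - xmax) ^ 2 := funext hpc
      rw [hpe]
      have h1 := (hd y hy).sub
        (((((hasDerivAt_id y).sub_const xmax).pow 2).const_mul c).const_sub (f xmax))
      refine h1.congr_deriv ?_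
      simp [G]
    have hmvt : ∀ u v, 0 < u → u < v → ∃ ξ ∈ Set.Ioo u v,
        G ξ = ((f v - p v) - (f u - p u)) / (v - u) := by
      intro u v hu huv
      exact exists_hasDerivAt_eq_slope (fun y => f y - p y) G huv
        (fun y hy => (hg y (hu.trans_le hy.1)).continuousAt.continuousWithinAt)
        (fun y hy => hg y (hu.trans hy.1))
    obtain ⟨s, hs, hs'⟩ := hmvt xmax x hm0 hxm
    obtain ⟨t, ht, ht'⟩ := hmvt x xroot (hm0.trans hxm) hxr
    have hsneg : G s < 0 := by
      rw [hs']; exact div_neg_of_neg_of_pos (by linarith) (by linarith)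
    have htpos : 0 < G t := by
      rw [ht']; exact div_pos (by linarith) (by linarith)
    have hGm : G xmax = 0 := by
      simp only [G]; rw [e1 _ hm0]; linear_combination (-xmax) * hm
    have hst : s < t := hs.2.trans ht.1
    have hconv := convexOn_rpow (p := α - 1) (by linarith)
    have hsl := hconv.slope_mono_adjacent (x := xmax) (y := s) (z := t) hm0.le
      (Set.mem_Ici.2 (by linarith [ht.1])) hs.1 hst
    have hA : 0 < s - xmax := by linarith [hs.1]
    have hB : 0 < t - s := by linarith
    rw [div_le_div_iff₀ hA hB] at hsl
    have hsl' := mul_le_mul_of_nonneg_left hsl haα.le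
    have h7 : (G t - G s) * (s - xmax) ≤ (G s - G xmax) * (t - s) := by
      simp only [G]; linarith
    rw [hGm] at h7
    have h8 : 0 < (G t - G s) * (s - xmax) := mul_pos (by linarith) hA
    have h9 : (G s - 0) * (t - s) < 0 := mul_neg_of_neg_of_pos (by linarith) hB
    linarith
end
end

section
/- Let α > 2 and define F_α(x) = (1/2)x² − (1/α)x^α, A = 1/2 − 1/α, B = (α/2)^{1/(α−2)}, and P_α(x) = A(1 − (x−1)²/(B−1)²). Then P_α(x) ≤ F_α(x) for all x ∈ [1, B]. -/
noncomputable section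

/-- Normalized tangent-parabola inequality: for `α > 2`, with
`F_α(x) = (1/2)x² − (1/α)x^α`, `A = 1/2 − 1/α`, `B = (α/2)^{1/(α−2)}` and
`P_α(x) = A(1 − (x−1)²/(B−1)²)`, one has `P_α(x) ≤ F_α(x)` for all `x ∈ [1, B]`. -/
theorem normalized_tangent_parabola
    (α : ℝ) (hα : 2 < α)
    (F : ℝ → ℝ) (hF : ∀ x : ℝ, F x = (1 / 2) * x ^ 2 - (1 / α) * x ^ α)
    (A B : ℝ)
    (hA : A = 1 / 2 - 1 / α)
    (hB : B = (α / 2) ^ ((1 : ℝ) / (α - 2)))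
    (P : ℝ → ℝ)
    (hP : ∀ x : ℝ, P x = A * (1 - (x - 1) ^ 2 / (B - 1) ^ 2)) :
    ∀ x ∈ Set.Icc 1 B, P x ≤ F x := by
  intro x hx
  obtain ⟨hx1, hxB⟩ := hx
  have h2 : 0 < α - 2 := by linarith
  have hα0 : α ≠ 0 := by linarith
  have hB1 : 1 < B := by
    rw [hB]
    exact Real.one_lt_rpow (by linarith) (by positivity)
  have hBa : B ^ α = B ^ 2 * (α / 2) := by
    have e1 : B ^ (α - 2) = α / 2 := by
      rw [hB, ← Real.rpow_mul (by linarith), one_div_mul_cancel h2.ne', Real.rpow_one]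
    have e2 : B ^ α = B ^ (2 : ℝ) * B ^ (α - 2) := by
      rw [← Real.rpow_add (by linarith)]
      congr 1
      ring
    rw [e2, e1, Real.rpow_two]
  obtain ⟨k, hk⟩ : ∃ k, k = A / (B - 1) ^ 2 := ⟨_, rfl⟩
  have hkB : k * (B - 1) ^ 2 = A := by
    rw [hk]
    have : B - 1 ≠ 0 := by linarith
    field_simp
  obtain ⟨G, hG⟩ : ∃ G : ℝ → ℝ, G = fun y => (1 / 2) * y ^ 2 - (1 / α) * y ^ α - A
      + k * (y - 1) ^ 2 := ⟨_, rfl⟩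
  obtain ⟨g, hg⟩ : ∃ g : ℝ → ℝ, g = fun y => y - y ^ (α - 1) + 2 * k * (y - 1) := ⟨_, rfl⟩
  have hGx : F x - P x = G x := by
    rw [hF, hP, hG, hk]
    ring
  have hG1 : G 1 = 0 := by
    simp only [hG, Real.one_rpow, hA]
    ring
  have hGB : G B = 0 := by
    simp only [hG, hBa, hkB]
    field_simp
    ring
  have hder : ∀ y : ℝ, 1 ≤ y → HasDerivAt G (g y) y := by
    intro y hy
    rw [hG, hg]
    have d1 := ((hasDerivAt_id y).pow 2).const_mul (1 / 2 : ℝ)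
    have d2 := (Real.hasDerivAt_rpow_const (x := y) (p := α) (Or.inl (by linarith))).const_mul (1 / α)
    have d3 := (((hasDerivAt_id y).sub_const 1).pow 2).const_mul k
    refine (((d1.sub d2).sub_const A).add d3).congr_deriv ?_
    simp
    field_simp
  suffices 0 ≤ G x by linarith
  by_contra! hneg
  have hx1' : 1 < x := lt_of_le_of_ne hx1 (by rintro rfl; linarith)
  have hxB' : x < B := lt_of_le_of_ne hxB (by rintro rfl; linarith)
  obtain ⟨c, hc, hc'⟩ := exists_hasDerivAt_eq_slope G g hx1'
    (fun y hy => (hder y hy.1).continuousAt.continuousWithinAt) (fun y hy => hder y hy.1.le)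
  obtain ⟨d, hd, hd'⟩ := exists_hasDerivAt_eq_slope G g hxB'
    (fun y hy => (hder y (hx1.trans hy.1)).continuousAt.continuousWithinAt)
    (fun y hy => hder y (hx1.trans hy.1.le))
  have hgc : g c < 0 := by
    rw [hc']
    exact div_neg_of_neg_of_pos (by linarith) (by linarith)
  have hgd : 0 < g d := by
    rw [hd']
    exact div_pos (by linarith) (by linarith)
  have hc1 := hc.1
  have hcx := hc.2
  have hdx := hd.1
  have hd1 : 0 < d - 1 := by linarith
  obtain ⟨t, ht⟩ : ∃ t, t = (c - 1) / (d - 1) := ⟨_, rfl⟩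
  have ht0 : 0 ≤ t := by rw [ht]; exact div_nonneg (by linarith) hd1.le
  have ht1 : t ≤ 1 := by rw [ht, div_le_one hd1]; linarith
  have htc : c = (1 - t) * 1 + t * d := by
    have : t * (d - 1) = c - 1 := by rw [ht]; field_simp
    linarith
  have hconv := (convexOn_rpow (p := α - 1) (by linarith)).2 (x := 1) (y := d)
    (by simp) (by simp only [Set.mem_Ici]; linarith) (sub_nonneg.2 ht1) ht0 (by ring)
  simp only [smul_eq_mul, Real.one_rpow, ← htc] at hconv
  have htg : 0 ≤ t * g d := mul_nonneg ht0 hgd.le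
  simp only [hg] at hgc htg
  have : c - c ^ (α - 1) + 2 * k * (c - 1) - t * (d - d ^ (α - 1) + 2 * k * (d - 1))
      = ((1 - t) * 1 + t * d ^ (α - 1)) - c ^ (α - 1) := by
    have e : c - 1 = t * (d - 1) := by linarith
    rw [e]
    linear_combination htc
  linarith
end
end

section
/- For every real x > 0, (1 + 1/√(x+2))^x ≥ (x+2)/2. -/
theorem second_derivative_comparison_aux {t : ℝ} (ht : Real.sqrt 2 ≤ t) :
    0 ≤ (t ^ 2 - 2) * (Real.log (t + 1) - Real.log t) - 2 * Real.log t + Real.log 2 := by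
  have h2 : (1.4 : ℝ) < Real.sqrt 2 := by
    apply Real.lt_sqrt_of_sq_lt
    norm_num
  have hd : ∀ s : ℝ, 0 < s → HasDerivAt
      (fun t : ℝ => (t ^ 2 - 2) * (Real.log (t + 1) - Real.log t) - 2 * Real.log t + Real.log 2)
      ((2 * s) * (Real.log (s + 1) - Real.log s) + (s ^ 2 - 2) * (1 / (s + 1) - 1 / s)
        - 2 * (1 / s)) s := by
    intro s hs
    have e1 : HasDerivAt (fun t : ℝ => t ^ 2 - 2) (2 * s) s := by
      simpa using ((hasDerivAt_id s).pow 2).sub_const 2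
    have e2 : HasDerivAt (fun t : ℝ => Real.log (t + 1)) (1 / (s + 1)) s :=
      ((hasDerivAt_id s).add_const 1).log (by simp only [id]; positivity)
    have e3 : HasDerivAt (fun t : ℝ => Real.log t) (1 / s) s :=
      (hasDerivAt_id s).log (by simp only [id]; positivity)
    exact ((e1.mul (e2.sub e3)).sub (e3.const_mul 2)).add_const _
  have hm : MonotoneOn
      (fun t : ℝ => (t ^ 2 - 2) * (Real.log (t + 1) - Real.log t) - 2 * Real.log t + Real.log 2)
      (Set.Ici (Real.sqrt 2)) := by
    apply monotoneOn_of_deriv_nonneg (convex_Ici _)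
    · intro s hs
      have : 0 < s := by linarith [Set.mem_Ici.1 hs]
      exact (hd s this).continuousAt.continuousWithinAt
    · intro s hs
      rw [interior_Ici] at hs
      have : 0 < s := by linarith [Set.mem_Ioi.1 hs]
      exact (hd s this).differentiableAt.differentiableWithinAt
    · intro s hs
      rw [interior_Ici] at hs
      have hs1 : 1.4 < s := by linarith [Set.mem_Ioi.1 hs]
      have hs0 : 0 < s := by linarith
      rw [(hd s hs0).deriv]
      have hl := Real.le_log_one_add_of_nonneg (x := 1 / s) (by positivity)
      have e : 1 + 1 / s = (s + 1) / s := by field_simp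
      rw [e, Real.log_div (by positivity) (by positivity)] at hl
      have hl2 : 2 * s * (2 * (1 / s) / (1 / s + 2)) ≤
          2 * s * (Real.log (s + 1) - Real.log s) :=
        mul_le_mul_of_nonneg_left hl (by positivity)
      have key : 2 * s * (2 * (1 / s) / (1 / s + 2)) + (s ^ 2 - 2) * (1 / (s + 1) - 1 / s)
          - 2 * (1 / s) = (2 * s ^ 2 - s - 2) / ((2 * s + 1) * (s + 1)) := by
        have : 1 / s + 2 = (2 * s + 1) / s := by field_simp; ring
        rw [this]
        field_simp
        ring
      have : 0 ≤ (2 * s ^ 2 - s - 2) / ((2 * s + 1) * (s + 1)) := by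
        apply div_nonneg _ (by positivity)
        nlinarith
      linarith
  have h := hm (Set.mem_Ici.2 le_rfl) (Set.mem_Ici.2 ht) ht
  have h0 : Real.log (Real.sqrt 2) = Real.log 2 / 2 := Real.log_sqrt (by norm_num)
  simp only [Real.sq_sqrt (show (0 : ℝ) ≤ 2 by norm_num), h0] at h
  linarith

/-- For every real `x > 0`, `(1 + 1/√(x+2))^x ≥ (x+2)/2`. -/
theorem second_derivative_comparison_inequality (x : ℝ) (hx : 0 < x) :
    (x + 2) / 2 ≤ (1 + 1 / Real.sqrt (x + 2)) ^ x := by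
  have ht : 0 < Real.sqrt (x + 2) := Real.sqrt_pos.2 (by linarith)
  have h := second_derivative_comparison_aux
    (Real.sqrt_le_sqrt (show (2 : ℝ) ≤ x + 2 by linarith))
  rw [Real.sq_sqrt (by linarith), ← Real.log_div (by positivity) (by positivity),
    Real.log_sqrt (by linarith)] at h
  have e : 1 + 1 / Real.sqrt (x + 2) = (Real.sqrt (x + 2) + 1) / Real.sqrt (x + 2) := by
    field_simp
  rw [e, ← Real.log_le_log_iff (by positivity) (by positivity), Real.log_rpow (by positivity),
    Real.log_div (x := x + 2) (by positivity) (by positivity)]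
  linarith
end

section
/- For every real x > 0, (1+x)^{1/(2x) + 1} · ((1+x)^{1/(2x)} − 1) > 1. -/
/-- For every real `x > 0`, `(1+x)^{1/(2x)+1} · ((1+x)^{1/(2x)} − 1) > 1`. -/
theorem slope_comparison_inequality (x : ℝ) (hx : 0 < x) :
    1 < (1 + x) ^ (1 / (2 * x) + 1) * ((1 + x) ^ (1 / (2 * x)) - 1) := by
  have h1 : 0 < 1 + x := by linarith
  rw [Real.rpow_add h1, Real.rpow_one]
  have hlog := Real.le_log_one_add_of_nonneg hx.le
  obtain ⟨u, hu⟩ : ∃ u : ℝ, u = 1 / (x + 2) := ⟨_, rfl⟩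
  have hu0 : 0 < u := by rw [hu]; positivity
  have hux : u * (x + 2) = 1 := by rw [hu]; field_simp
  have hu2 : u < 1 / 2 := by nlinarith
  have ht : u ≤ Real.log (1 + x) * (1 / (2 * x)) := by
    calc u = (2 * x / (x + 2)) * (1 / (2 * x)) := by rw [hu]; field_simp
      _ ≤ _ := by gcongr
  have ha : 1 + u + u ^ 2 / 2 ≤ (1 + x) ^ (1 / (2 * x)) := by
    rw [Real.rpow_def_of_pos h1]
    exact (Real.quadratic_le_exp_of_nonneg hu0.le).trans (Real.exp_le_exp.mpr ht)
  generalize (1 + x) ^ (1 / (2 * x)) = a at ha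
  have hp : 1 < (1 + u + u ^ 2 / 2) * (1 + x) * (u + u ^ 2 / 2) := by
    have e : (1 + u + u ^ 2 / 2) * (1 + x) * (u + u ^ 2 / 2)
        = (1 + u + u ^ 2 / 2) * (1 + u / 2) * (1 - u) := by
      linear_combination (1 + u + u ^ 2 / 2) * (1 + u / 2) * hux
    have hq : 0 < u * (1 / 2 - u / 2 - 3 / 4 * u ^ 2 - u ^ 3 / 4) := by
      apply mul_pos hu0
      have h2 : u ^ 2 < 1 / 4 := by nlinarith
      have h3 : u ^ 3 < 1 / 8 := by nlinarith
      linarith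
    rw [e]; linarith
  calc 1 < _ := hp
    _ ≤ a * (1 + x) * (a - 1) := by
      have : u + u ^ 2 / 2 ≤ a - 1 := by linarith
      have : 0 ≤ a := le_trans (by positivity) ha
      gcongr
end
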